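/- Tiling property for Tempelman Følner sequences: let Γ be a countable amenable group acting freely and pmp on a standard probability space (X,μ), and let (F_n) be an increasing Følner sequence with Tempelman constant C. Then for any sequence of measurable functions ℓ_i : X → ℕ that is pointwise strictly increasing in i, and any ε > 0, there exist arbitrarily large (with respect to inclusion/exhaustion of Γ) finite sets T ⊆ Γ such that for a set of points x of measure at least 1-ε, at least a (1-ε)-fraction of T·x can be partitioned into pairwise disjoint sets of the form F_{ℓ_i(y)}·y with y ∈ T·x. -/

import Mathlib

open Pointwise MeasureTheory Filter

/-- The `R'`-boundary of a set `S` in a group. -/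
def bdry {Γ : Type*} [Group Γ] (R' S : Set Γ) : Set Γ :=
  {s | (∃ r ∈ R', r * s ∈ S) ∧ (∃ r ∈ R', r * s ∉ S)}

/-- The `R`-boundary of a finite set, as a finite set. -/
def finBdry {Γ : Type*} [Group Γ] [DecidableEq Γ] (R S : Finset Γ) : Finset Γ :=
  (R⁻¹ * S).filter fun s => ∃ r ∈ R, r * s ∉ S

section FinBdry

variable {Γ : Type*} [Group Γ] [DecidableEq Γ]

theorem mem_finBdry {R S : Finset Γ} {s : Γ} :
    s ∈ finBdry R S ↔ (∃ r ∈ R, r * s ∈ S) ∧ ∃ r ∈ R, r * s ∉ S := by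
  have h : s ∈ R⁻¹ * S ↔ ∃ r ∈ R, r * s ∈ S := by
    rw [Finset.mem_mul]
    constructor
    · rintro ⟨a, ha, b, hb, rfl⟩
      exact ⟨a⁻¹, Finset.mem_inv'.1 ha, by simpa using hb⟩
    · rintro ⟨r, hr, hs⟩
      exact ⟨r⁻¹, Finset.inv_mem_inv hr, r * s, hs, by simp⟩
  rw [finBdry, Finset.mem_filter, h]

theorem coe_finBdry (R S : Finset Γ) : (finBdry R S : Set Γ) = bdry (R : Set Γ) (S : Set Γ) := by
  ext s
  simp only [Finset.mem_coe, mem_finBdry, bdry, Set.mem_ofPred_eq]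

theorem finBdry_mono {R R' : Finset Γ} (h : R ⊆ R') (S : Finset Γ) :
    finBdry R S ⊆ finBdry R' S := by
  intro s hs
  rw [mem_finBdry] at hs ⊢
  obtain ⟨⟨a, ha, ha'⟩, b, hb, hb'⟩ := hs
  exact ⟨⟨a, h ha, ha'⟩, b, h hb, hb'⟩

theorem exists_forall_card_finBdry_le {F : ℕ → Finset Γ} (hne : ∀ n, (F n).Nonempty)
    (hFol : ∀ R : Finset Γ,
      Tendsto (fun n => ((bdry (R : Set Γ) ((F n : Set Γ))).ncard : ℝ) / (F n).card)
        atTop (nhds 0))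
    (R : Finset Γ) {δ : ℝ} (hδ : 0 < δ) :
    ∃ m, ∀ n ≥ m, ((finBdry R (F n)).card : ℝ) ≤ δ * (F n).card := by
  obtain ⟨m, hm⟩ := eventually_atTop.1 ((hFol R).eventually (gt_mem_nhds hδ))
  refine ⟨m, fun n hn => ?_⟩
  have hpos : (0 : ℝ) < (F n).card := by exact_mod_cast (hne n).card_pos
  have h := hm n hn
  rw [← coe_finBdry, Set.ncard_coe_finset, div_lt_iff₀ hpos] at h
  exact h.le

end FinBdry

theorem mem_mul_singleton_iff {Γ : Type*} [Group Γ] [DecidableEq Γ] {S : Finset Γ} {c z : Γ} :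
    z ∈ S * ({c} : Finset Γ) ↔ ∃ s ∈ S, s * c = z := by
  simp only [Finset.mem_mul, Finset.mem_singleton, exists_eq_left]

/-- Vitali covering for right translates of sets satisfying the Tempelman condition. -/
theorem exists_disjoint_translates {Γ : Type*} [Group Γ] [DecidableEq Γ]
    {F : ℕ → Finset Γ} (hne : ∀ n, (F n).Nonempty) {C : ℝ}
    (hTemp : ∀ n, ((((Finset.range (n + 1)).biUnion fun k => (F k)⁻¹ * F n)).card : ℝ) ≤
      C * (F n).card) (L : Γ → ℕ) (G : Finset Γ) :
    ∃ S ⊆ G, ((S : Set Γ).Pairwise fun a b =>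
        Disjoint (F (L a) * ({a} : Finset Γ)) (F (L b) * ({b} : Finset Γ))) ∧
      (G.card : ℝ) ≤ C * ((S.biUnion fun a => F (L a) * ({a} : Finset Γ)).card : ℝ) := by
  induction G using Finset.strongInduction with
  | H G ih =>
    rcases G.eq_empty_or_nonempty with rfl | hG
    · exact ⟨∅, subset_rfl, by simp, by simp⟩
    obtain ⟨c, hc, hmax⟩ := G.exists_max_image L hG
    set D : Γ → Finset Γ := fun a => F (L a) * ({a} : Finset Γ) with hD
    set G' := G.filter fun a => Disjoint (D c) (D a) with hG'
    have hcne : (D c).Nonempty := (hne _).mul (Finset.singleton_nonempty _)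
    have hcG' : c ∉ G' := by
      intro h
      have := (Finset.mem_filter.1 h).2
      rw [disjoint_self] at this
      exact hcne.ne_empty this
    have hlt : G' ⊂ G :=
      (Finset.ssubset_iff_of_subset (Finset.filter_subset _ _)).2 ⟨c, hc, hcG'⟩
    obtain ⟨S, hSG, hS, hcard⟩ := ih G' hlt
    have hdis : ∀ a ∈ S, Disjoint (D c) (D a) := fun a ha => (Finset.mem_filter.1 (hSG ha)).2
    refine ⟨insert c S, ?_, ?_, ?_⟩
    · exact Finset.insert_subset hc (hSG.trans hlt.subset)
    · rw [Finset.coe_insert, Set.pairwise_insert]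
      exact ⟨hS, fun b hb _ => ⟨hdis b hb, (hdis b hb).symm⟩⟩
    · have hsub : G \ G' ⊆
          ((Finset.range (L c + 1)).biUnion fun k => (F k)⁻¹ * F (L c)) * ({c} : Finset Γ) := by
        intro a ha
        obtain ⟨haG, haG'⟩ := Finset.mem_sdiff.1 ha
        have hnd : ¬ Disjoint (D c) (D a) := fun h => haG' (Finset.mem_filter.2 ⟨haG, h⟩)
        obtain ⟨z, hzc, hza⟩ := Finset.not_disjoint_iff.1 hnd
        simp only [hD, mem_mul_singleton_iff] at hzc hza
        obtain ⟨g, hg, rfl⟩ := hzc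
        obtain ⟨f, hf, hfg⟩ := hza
        rw [mem_mul_singleton_iff]
        refine ⟨f⁻¹ * g, ?_, ?_⟩
        · exact Finset.mem_biUnion.2 ⟨L a, Finset.mem_range.2 (Nat.lt_succ_of_le (hmax a haG)),
            Finset.mul_mem_mul (Finset.inv_mem_inv hf) hg⟩
        · rw [mul_assoc, ← hfg]
          simp
      have h₁ : ((G \ G').card : ℝ) ≤ C * (D c).card := by
        refine le_trans ?_ ((hTemp (L c)).trans_eq ?_)
        · exact_mod_cast (Finset.card_le_card hsub).trans_eq (Finset.card_mul_singleton _ _)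
        · simp only [hD, Finset.card_mul_singleton]
      have h₂ : ((insert c S).biUnion D).card = (D c).card + (S.biUnion D).card := by
        rw [Finset.biUnion_insert, Finset.card_union_of_disjoint]
        exact (Finset.disjoint_biUnion_right _ _ _).2 hdis
      have h₃ : ((G \ G').card : ℝ) + G'.card = G.card := by
        exact_mod_cast Finset.card_sdiff_add_card_eq_card hlt.subset
      rw [h₂]
      push_cast
      linarith

theorem exists_measure_lt_natCast_le {X : Type*} [MeasurableSpace X] (μ : Measure X)
    [IsFiniteMeasure μ] {f : X → ℕ} (hf : Measurable f) {η : ENNReal} (hη : 0 < η) :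
    ∃ b : ℕ, μ {x | b < f x} ≤ η := by
  have h : Tendsto (fun b : ℕ => μ {x | b < f x}) atTop (nhds (μ (⋂ b : ℕ, {x | b < f x}))) := by
    refine tendsto_measure_iInter_atTop
      (fun b => (measurableSet_lt measurable_const hf).nullMeasurableSet) ?_
      ⟨0, measure_ne_top _ _⟩
    intro a b hab x hx
    exact lt_of_le_of_lt hab hx
  have h0 : (⋂ b : ℕ, {x | b < f x}) = ∅ := by
    ext x
    simp only [Set.mem_iInter, Set.mem_ofPred_eq, Set.mem_empty_iff_false, iff_false, not_forall]
    exact ⟨f x, lt_irrefl _⟩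
  rw [h0, measure_empty] at h
  obtain ⟨b, hb⟩ := (h.eventually (gt_mem_nhds hη)).exists
  exact ⟨b, hb.le⟩

/-- For a measure-preserving action, most points have few translates in a small set. -/
theorem one_sub_le_measure_card_filter_le {Γ X : Type*} [Group Γ] [MulAction Γ X] [MeasurableSpace X]
    (μ : Measure X) [IsProbabilityMeasure μ]
    (hpres : ∀ γ : Γ, MeasurePreserving (fun x : X => γ • x) μ μ)
    {B : Set X} [DecidablePred (· ∈ B)] (hB : MeasurableSet B) {δ ε : ℝ} (hδ : 0 < δ)
    (hε : 0 ≤ ε) (hμ : μ B ≤ ENNReal.ofReal (ε * δ)) {T : Finset Γ} (hT : T.Nonempty) :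
    1 - ε ≤ (μ {x | ((T.filter fun t => t • x ∈ B).card : ℝ) ≤ δ * T.card}).toReal := by
  set A : Set X := {x | ((T.filter fun t => t • x ∈ B).card : ℝ) ≤ δ * T.card} with hA
  set f : X → ℝ := fun x => ∑ t ∈ T, B.indicator (fun _ => (1 : ℝ)) (t • x) with hf
  have hfc : ∀ x, ((T.filter fun t => t • x ∈ B).card : ℝ) = f x := by
    intro x
    simp only [hf, Finset.card_filter, Set.indicator_apply]
    push_cast
    rfl
  have hind : Measurable (B.indicator (fun _ => (1 : ℝ))) := measurable_const.indicator hB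
  have hfm : Measurable f :=
    Finset.measurable_sum _ fun t _ => hind.comp (hpres t).measurable
  have hAm : MeasurableSet A := by
    simp only [hA, hfc]
    exact measurableSet_le hfm measurable_const
  have hint : ∀ t ∈ T, Integrable (fun x => B.indicator (fun _ => (1 : ℝ)) (t • x)) μ :=
    fun t _ => (hpres t).integrable_comp_of_integrable ((integrable_const 1).indicator hB)
  have hfint : ∫ x, f x ∂μ = T.card * μ.real B := by
    have h1 : ∀ t ∈ T, ∫ x, B.indicator (fun _ => (1 : ℝ)) (t • x) ∂μ = μ.real B := by
      intro t _
      have h := integral_map (hpres t).measurable.aemeasurable (μ := μ)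
        (f := B.indicator (fun _ => (1 : ℝ))) hind.aestronglyMeasurable
      rw [(hpres t).map_eq] at h
      rw [← h, integral_indicator_const _ hB]
      simp
    simp only [hf]
    rw [integral_finsetSum _ hint, Finset.sum_congr rfl h1, Finset.sum_const, nsmul_eq_mul]
  have hmarkov := mul_meas_ge_le_integral_of_nonneg (μ := μ) (f := f)
    (ae_of_all _ fun x => by
      simp only [← hfc]
      positivity) (integrable_finsetSum _ hint) (δ * T.card)
  rw [hfint] at hmarkov
  have hcompl : μ.real Aᶜ ≤ μ.real {x | δ * T.card ≤ f x} := by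
    refine measureReal_mono fun x hx => ?_
    simp only [hA, hfc, Set.mem_compl_iff, Set.mem_ofPred_eq, not_le] at hx
    exact hx.le
  have hBr : μ.real B ≤ ε * δ := ENNReal.toReal_le_of_le_ofReal (by positivity) hμ
  have hTpos : (0 : ℝ) < T.card := by exact_mod_cast hT.card_pos
  have hAc : μ.real Aᶜ ≤ ε := by
    have h1 : δ * T.card * μ.real Aᶜ ≤ δ * T.card * ε := by
      calc δ * T.card * μ.real Aᶜ ≤ δ * T.card * μ.real {x | δ * T.card ≤ f x} := by gcongr
        _ ≤ T.card * μ.real B := hmarkov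
        _ ≤ T.card * (ε * δ) := by gcongr
        _ = δ * T.card * ε := by ring
    exact le_of_mul_le_mul_left h1 (by positivity)
  have hsum := probReal_compl_eq_one_sub (μ := μ) hAm
  change 1 - ε ≤ μ.real A
  linarith

/-- One level of the tiling: a family `Q` of disjoint tiles inside `T` that are almost invariant
under `R` can be enlarged by tiles of index `a` at points outside `bad`, so that the uncovered part
of `T` shrinks by a factor `1 - 1 / C`, up to an error. -/
theorem exists_extend_tiling {Γ : Type*} [Group Γ] [DecidableEq Γ]
    {F : ℕ → Finset Γ} (hne : ∀ n, (F n).Nonempty) (hF : Monotone F) {C : ℝ} (hC : 0 < C)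
    (hTemp : ∀ n, ((((Finset.range (n + 1)).biUnion fun k => (F k)⁻¹ * F n)).card : ℝ) ≤
      C * (F n).card)
    {R T bad : Finset Γ} (h1 : 1 ∈ R) {a b : ℕ} (hb : F b ⊆ R) {δ : ℝ} (hδ : 0 ≤ δ)
    (hT : ((finBdry R T).card : ℝ) ≤ δ * T.card) (hbad : (bad.card : ℝ) ≤ δ * T.card)
    (L : ℕ → Γ → ℕ) (hL : ∀ γ ∈ T, γ ∉ bad → L a γ ≤ b)
    {Q : Finset (Γ × ℕ)}
    (hQdis : (Q : Set (Γ × ℕ)).Pairwise fun p q =>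
      Disjoint (F (L p.2 p.1) * ({p.1} : Finset Γ)) (F (L q.2 q.1) * ({q.1} : Finset Γ)))
    (hQT : ∀ p ∈ Q, F (L p.2 p.1) * ({p.1} : Finset Γ) ⊆ T)
    (hQR : ∀ p ∈ Q, ((finBdry R (F (L p.2 p.1))).card : ℝ) ≤ δ * (F (L p.2 p.1)).card) :
    ∃ Q' : Finset (Γ × ℕ), Q ⊆ Q' ∧ (∀ p ∈ Q', p ∉ Q → p.2 = a ∧ p.1 ∈ T) ∧
      ((Q' : Set (Γ × ℕ)).Pairwise fun p q =>
        Disjoint (F (L p.2 p.1) * ({p.1} : Finset Γ)) (F (L q.2 q.1) * ({q.1} : Finset Γ))) ∧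
      (∀ p ∈ Q', F (L p.2 p.1) * ({p.1} : Finset Γ) ⊆ T) ∧
      (T.card : ℝ) - ((Q'.biUnion fun p => F (L p.2 p.1) * ({p.1} : Finset Γ)).card : ℝ) ≤
        (1 - 1 / C) *
          (T.card - ((Q.biUnion fun p => F (L p.2 p.1) * ({p.1} : Finset Γ)).card : ℝ)) +
        1 / C * (3 * δ * T.card) := by
  set D : Γ × ℕ → Finset Γ := fun p => F (L p.2 p.1) * ({p.1} : Finset Γ) with hD
  have hWT : Q.biUnion D ⊆ T := Finset.biUnion_subset.2 hQT
  set U := T \ Q.biUnion D with hU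
  have hUcard : (U.card : ℝ) = T.card - (Q.biUnion D).card := by
    rw [hU, Finset.cast_card_sdiff hWT]
  set G := U.filter fun γ => γ ∉ bad ∧ D (γ, a) ⊆ U with hG
  set E := Q.biUnion fun p => finBdry R (F (L p.2 p.1)) * ({p.1} : Finset Γ) with hE
  have hEcard : (E.card : ℝ) ≤ δ * T.card := by
    have hsum : (∑ p ∈ Q, ((F (L p.2 p.1)).card : ℝ)) ≤ T.card := by
      have h2 : (Q.biUnion D).card = ∑ p ∈ Q, (F (L p.2 p.1)).card := by
        rw [Finset.card_biUnion fun p hp q hq hpq => hQdis hp hq hpq]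
        simp only [Finset.card_mul_singleton]
      exact_mod_cast h2 ▸ Finset.card_le_card hWT
    calc (E.card : ℝ)
        ≤ ∑ p ∈ Q, ((finBdry R (F (L p.2 p.1)) * ({p.1} : Finset Γ)).card : ℝ) := by
          exact_mod_cast Finset.card_biUnion_le
      _ = ∑ p ∈ Q, ((finBdry R (F (L p.2 p.1))).card : ℝ) := by
          simp only [Finset.card_mul_singleton]
      _ ≤ ∑ p ∈ Q, δ * ((F (L p.2 p.1)).card : ℝ) := Finset.sum_le_sum hQR
      _ ≤ δ * T.card := by
          rw [← Finset.mul_sum]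
          gcongr
  have hcov : U ⊆ G ∪ (bad ∪ (finBdry R T ∪ E)) := by
    intro γ hγ
    by_contra hcon
    simp only [Finset.mem_union, not_or] at hcon
    obtain ⟨hγG, hγbad, hγT, hγE⟩ := hcon
    obtain ⟨hγT', hγW⟩ := Finset.mem_sdiff.1 hγ
    refine hγG (Finset.mem_filter.2 ⟨hγ, hγbad, fun z hz => ?_⟩)
    simp only [hD, mem_mul_singleton_iff] at hz
    obtain ⟨r, hr, rfl⟩ := hz
    have hrR : r ∈ R := hb (hF (hL γ hγT' hγbad) hr)
    refine Finset.mem_sdiff.2 ⟨?_, fun hmem => ?_⟩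
    · by_contra hrT
      exact hγT (mem_finBdry.2 ⟨⟨1, h1, by simpa using hγT'⟩, r, hrR, hrT⟩)
    · obtain ⟨p, hp, hpz⟩ := Finset.mem_biUnion.1 hmem
      simp only [hD, mem_mul_singleton_iff] at hpz
      obtain ⟨f, hf, hfr⟩ := hpz
      refine hγE (Finset.mem_biUnion.2 ⟨p, hp, ?_⟩)
      rw [mem_mul_singleton_iff]
      refine ⟨γ * p.1⁻¹, mem_finBdry.2 ⟨⟨r, hrR, ?_⟩, 1, h1, fun h => ?_⟩, by simp⟩
      · rw [← mul_assoc, ← hfr]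
        simpa using hf
      · refine hγW (Finset.mem_biUnion.2 ⟨p, hp, ?_⟩)
        simp only [hD, mem_mul_singleton_iff]
        exact ⟨γ * p.1⁻¹, by simpa using h, by simp⟩
  have hGcard : (U.card : ℝ) ≤ G.card + 3 * δ * T.card := by
    have h2 : (U.card : ℝ) ≤ G.card + (bad.card + ((finBdry R T).card + E.card)) := by
      have h3 := Finset.card_le_card hcov
      have h4 := Finset.card_union_le G (bad ∪ (finBdry R T ∪ E))
      have h5 := Finset.card_union_le bad (finBdry R T ∪ E)
      have h6 := Finset.card_union_le (finBdry R T) E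
      exact_mod_cast (by omega : U.card ≤ G.card + (bad.card + ((finBdry R T).card + E.card)))
    linarith
  obtain ⟨S, hSG, hSdis, hScard⟩ := exists_disjoint_translates hne hTemp (L a) G
  have hSU : ∀ γ ∈ S, D (γ, a) ⊆ U := fun γ hγ => (Finset.mem_filter.1 (hSG hγ)).2.2
  have hmemQ : ∀ p, p ∈ Q ∪ S.image (fun γ => (γ, a)) ↔ p ∈ Q ∨ ∃ γ ∈ S, (γ, a) = p := by
    intro p
    rw [Finset.mem_union, Finset.mem_image]
  have hcross : ∀ p ∈ Q, ∀ γ ∈ S, Disjoint (D p) (D (γ, a)) := fun p hp γ hγ =>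
    (Finset.disjoint_sdiff (s := Q.biUnion D) (t := T)).mono
      (Finset.subset_biUnion_of_mem D hp) (hSU γ hγ)
  refine ⟨Q ∪ S.image (fun γ => (γ, a)), Finset.subset_union_left, ?_, ?_, ?_, ?_⟩
  · intro p hp hpQ
    obtain h | ⟨γ, hγ, rfl⟩ := (hmemQ p).1 hp
    · exact absurd h hpQ
    · exact ⟨rfl, (Finset.mem_sdiff.1 (Finset.mem_filter.1 (hSG hγ)).1).1⟩
  · intro p hp q hq hpq
    obtain hp | ⟨γ, hγ, rfl⟩ := (hmemQ p).1 hp <;> obtain hq | ⟨γ', hγ', rfl⟩ := (hmemQ q).1 hq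
    · exact hQdis hp hq hpq
    · exact hcross p hp γ' hγ'
    · exact (hcross q hq γ hγ).symm
    · exact hSdis hγ hγ' fun h => hpq (by rw [h])
  · intro p hp
    obtain hp | ⟨γ, hγ, rfl⟩ := (hmemQ p).1 hp
    · exact hQT p hp
    · exact (hSU γ hγ).trans Finset.sdiff_subset
  · have hcard : ((Q ∪ S.image (fun γ => (γ, a))).biUnion D).card =
        (Q.biUnion D).card + (S.biUnion fun γ => D (γ, a)).card := by
      rw [Finset.union_biUnion, Finset.image_biUnion, Finset.card_union_of_disjoint]
      exact (Finset.disjoint_biUnion_left _ _ _).2 fun p hp =>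
        (Finset.disjoint_biUnion_right _ _ _).2 fun γ hγ => hcross p hp γ hγ
    rw [hcard]
    push_cast
    have hS : 1 / C * G.card ≤ ((S.biUnion fun γ => D (γ, a)).card : ℝ) := by
      rw [one_div, inv_mul_le_iff₀ hC]
      exact hScard
    have hmul : 1 / C * U.card ≤ 1 / C * (G.card + 3 * δ * T.card) := by gcongr
    rw [hUcard] at hmul
    linarith

/-- Tilings with `N` levels: outside a small set of exceptional points, all large Følner sets admit
a disjoint family of almost `R`-invariant tiles leaving uncovered at most a proportion
`3 * δ + (1 - 1 / C) ^ N`. -/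
theorem exists_multilevel_tiling {Γ X : Type*} [Group Γ] [DecidableEq Γ]
    [MulAction Γ X] [MeasurableSpace X] (μ : Measure X) [IsProbabilityMeasure μ]
    {F : ℕ → Finset Γ} (hne : ∀ n, (F n).Nonempty) (hF : Monotone F)
    (hFol : ∀ R : Finset Γ,
      Tendsto (fun n => ((bdry (R : Set Γ) ((F n : Set Γ))).ncard : ℝ) / (F n).card)
        atTop (nhds 0))
    {C : ℝ} (hC : 1 ≤ C)
    (hTemp : ∀ n, ((((Finset.range (n + 1)).biUnion fun k => (F k)⁻¹ * F n)).card : ℝ) ≤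
      C * (F n).card)
    {ℓ : ℕ → X → ℕ} (hmeas : ∀ i, Measurable (ℓ i)) (hℓ : ∀ i x, i ≤ ℓ i x)
    {δ : ℝ} (hδ : 0 < δ) (N : ℕ) (R : Finset Γ) {η : ENNReal} (hη : 0 < η) :
    ∃ B : Set X, MeasurableSet B ∧ μ B ≤ η ∧ ∃ n₀, ∀ n ≥ n₀, ∀ x : X, ∀ bad : Finset Γ,
      (∀ γ ∈ F n, γ • x ∈ B → γ ∈ bad) → (bad.card : ℝ) ≤ δ * (F n).card →
      ∃ Q : Finset (Γ × ℕ), (∀ p ∈ Q, p.1 ∈ F n) ∧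
        ((Q : Set (Γ × ℕ)).Pairwise fun p q =>
          Disjoint (F (ℓ p.2 (p.1 • x)) * ({p.1} : Finset Γ))
            (F (ℓ q.2 (q.1 • x)) * ({q.1} : Finset Γ))) ∧
        (∀ p ∈ Q, F (ℓ p.2 (p.1 • x)) * ({p.1} : Finset Γ) ⊆ F n) ∧
        (∀ p ∈ Q, ((finBdry R (F (ℓ p.2 (p.1 • x)))).card : ℝ) ≤
          δ * (F (ℓ p.2 (p.1 • x))).card) ∧
        ((F n).card : ℝ) -
            ((Q.biUnion fun p => F (ℓ p.2 (p.1 • x)) * ({p.1} : Finset Γ)).card : ℝ) ≤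
          (3 * δ + (1 - 1 / C) ^ N) * (F n).card := by
  induction N generalizing R η with
  | zero =>
    refine ⟨∅, MeasurableSet.empty, by simp, 0, fun n _ x bad _ _ => ⟨∅, by simp, by simp, by simp,
      by simp, ?_⟩⟩
    have : (0 : ℝ) ≤ δ * (F n).card := by positivity
    simp only [Finset.biUnion_empty, Finset.card_empty, pow_zero]
    push_cast
    linarith
  | succ N ih =>
    obtain ⟨a, ha⟩ := exists_forall_card_finBdry_le hne hFol R hδ
    obtain ⟨b, hb⟩ := exists_measure_lt_natCast_le μ (hmeas a) (ENNReal.half_pos hη.ne')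
    set R' : Finset Γ := insert 1 (R ∪ F b) with hR'
    have hRR' : R ⊆ R' := Finset.subset_union_left.trans (Finset.subset_insert _ _)
    have hbR' : F b ⊆ R' := Finset.subset_union_right.trans (Finset.subset_insert _ _)
    obtain ⟨B, hBm, hBμ, n₁, hB⟩ := ih R' (ENNReal.half_pos hη.ne')
    obtain ⟨n₂, hn₂⟩ := exists_forall_card_finBdry_le hne hFol R' hδ
    refine ⟨B ∪ {x | b < ℓ a x}, hBm.union (measurableSet_lt measurable_const (hmeas a)), ?_,
      max n₁ n₂, fun n hn x bad hbad hcard => ?_⟩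
    · exact (measure_union_le _ _).trans ((add_le_add hBμ hb).trans_eq (ENNReal.add_halves η))
    obtain ⟨Q, hQ, hQdis, hQT, hQR, hQcard⟩ := hB n ((le_max_left _ _).trans hn) x bad
      (fun γ hγ h => hbad γ hγ (Or.inl h)) hcard
    obtain ⟨Q', hQQ', hQ'Q, hdis, hT, hQ'card⟩ := exists_extend_tiling (T := F n) (a := a) hne hF
      (zero_lt_one.trans_le hC) hTemp (Finset.mem_insert_self 1 _) hbR' hδ.le
      (hn₂ n ((le_max_right _ _).trans hn)) hcard (fun i γ => ℓ i (γ • x))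
      (fun γ hγ hγb => not_lt.1 fun h => hγb (hbad γ hγ (Or.inr h))) hQdis hQT hQR
    refine ⟨Q', fun p hp => ?_, hdis, hT, fun p hp => ?_, hQ'card.trans ?_⟩
    · by_cases hpQ : p ∈ Q
      · exact hQ p hpQ
      · exact (hQ'Q p hp hpQ).2
    · by_cases hpQ : p ∈ Q
      · refine le_trans ?_ (hQR p hpQ)
        exact_mod_cast Finset.card_le_card (finBdry_mono hRR' _)
      · refine ha _ ?_
        rw [(hQ'Q p hp hpQ).1]
        exact hℓ _ _
    · have hq : 0 ≤ 1 - 1 / C := sub_nonneg.2 ((div_le_one (zero_lt_one.trans_le hC)).2 hC)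
      have := mul_le_mul_of_nonneg_left hQcard hq
      rw [pow_succ]
      linarith

/-- The tiling property holds for free pmp actions of amenable groups along increasing
Tempelman Følner sequences.  A tiling of `T · x` is encoded as a finite set `Q` of pairs
`(γ, i)` with `γ ∈ T`, the pair `(γ, i)` representing the tile
`F (ℓ i (γ • x)) · (γ • x)`, viewed inside `T` as the subset `F (ℓ i (γ • x)) * {γ}`
of `Γ`; "arbitrarily large `T`" means `T` may be chosen containing any prescribed
finite set `T₀ ⊆ Γ`. -/
theorem tiling_property_tempelman {Γ X : Type*} [Group Γ] [Countable Γ] [DecidableEq Γ]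
    [MulAction Γ X] [MeasurableSpace X] [StandardBorelSpace X]
    (μ : Measure X) [IsProbabilityMeasure μ]
    (hfree : ∀ (γ : Γ) (x : X), γ • x = x → γ = 1)
    (hpres : ∀ γ : Γ, MeasurePreserving (fun x : X => γ • x) μ μ)
    (F : ℕ → Finset Γ) (hne : ∀ n, (F n).Nonempty)
    (hmono : ∀ n, F n ⊆ F (n + 1))
    (hcover : ∀ g : Γ, ∃ n, g ∈ F n)
    (hFol : ∀ R : Finset Γ,
      Tendsto (fun n => ((bdry (R : Set Γ) ((F n : Set Γ))).ncard : ℝ) / (F n).card)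
        atTop (nhds 0))
    (C : ℝ)
    (hTemp : ∀ n, ((((Finset.range (n + 1)).biUnion fun k => (F k)⁻¹ * F n)).card : ℝ) ≤
      C * (F n).card)
    (ℓ : ℕ → X → ℕ) (hmeas : ∀ i, Measurable (ℓ i))
    (hinc : ∀ (i : ℕ) (x : X), ℓ i x < ℓ (i + 1) x)
    (ε : ℝ) (hε : 0 < ε) (T₀ : Finset Γ) :
    ∃ T : Finset Γ, T₀ ⊆ T ∧ T.Nonempty ∧
      1 - ε ≤ (μ {x : X | ∃ Q : Finset (Γ × ℕ),
        (∀ p ∈ Q, p.1 ∈ T) ∧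
        ((Q : Set (Γ × ℕ)).Pairwise fun p q =>
          Disjoint (F (ℓ p.2 (p.1 • x)) * ({p.1} : Finset Γ))
            (F (ℓ q.2 (q.1 • x)) * ({q.1} : Finset Γ))) ∧
        (∀ p ∈ Q, F (ℓ p.2 (p.1 • x)) * ({p.1} : Finset Γ) ⊆ T) ∧
        (1 - ε) * (T.card : ℝ) ≤
          ((Q.biUnion fun p => F (ℓ p.2 (p.1 • x)) * ({p.1} : Finset Γ)).card : ℝ)}).toReal := by
  classical
  have hF : Monotone F := monotone_nat_of_le_succ hmono
  have hC : 1 ≤ C := by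
    have hpos : (0 : ℝ) < (F 0).card := by exact_mod_cast (hne 0).card_pos
    have h : ((F 0).card : ℝ) ≤ C * (F 0).card := by
      refine le_trans ?_ (hTemp 0)
      norm_cast
      refine (Finset.card_le_card_mul_left (hne 0).inv).trans (Finset.card_le_card ?_)
      exact Finset.subset_biUnion_of_mem (fun k => (F k)⁻¹ * F 0) (Finset.mem_range.2 zero_lt_one)
    exact le_of_mul_le_mul_right (by simpa using h) hpos
  have hℓ : ∀ i x, i ≤ ℓ i x := fun i x => (strictMono_nat_of_lt_succ fun i => hinc i x).le_apply
  have hC0 : 0 < C := zero_lt_one.trans_le hC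
  obtain ⟨N, hN⟩ := exists_pow_lt_of_lt_one (half_pos hε)
    (sub_lt_self (1 : ℝ) (one_div_pos.2 hC0))
  have hδ : 0 < ε / 6 := by positivity
  obtain ⟨B, hBm, hBμ, n₀, hB⟩ := exists_multilevel_tiling μ hne hF hFol hC hTemp hmeas hℓ hδ N ∅
    (η := ENNReal.ofReal (ε * (ε / 6))) (ENNReal.ofReal_pos.2 (by positivity))
  choose m hm using hcover
  refine ⟨F (max n₀ (T₀.sup m)), fun g hg =>
    hF ((Finset.le_sup hg).trans (le_max_right _ _)) (hm g), hne _, ?_⟩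
  set T := F (max n₀ (T₀.sup m))
  refine (one_sub_le_measure_card_filter_le μ hpres hBm hδ hε.le hBμ (hne _ : T.Nonempty)).trans
    (ENNReal.toReal_mono (measure_ne_top _ _) (measure_mono fun x hx => ?_))
  obtain ⟨Q, hQ, hQdis, hQT, -, hQcard⟩ := hB _ (le_max_left _ _) x
    (T.filter fun t => t • x ∈ B) (fun γ hγ h => Finset.mem_filter.2 ⟨hγ, h⟩) hx
  refine ⟨Q, hQ, hQdis, hQT, ?_⟩
  have hle : (3 * (ε / 6) + (1 - 1 / C) ^ N) * (T.card : ℝ) ≤ ε * T.card := by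
    gcongr
    linarith
  linarith
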